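/- Let Z be a type with a distinguished null record ⊥, n a positive natural number, C > 0, σ > 0, δ_t ∈ (0, 1), φ : Z → EuclideanSpace ℝ (Fin k) with φ(⊥) = 0, and weights w : Fin n → ℝ with 0 < w i ≤ 1. Let M map D to the product Gaussian measure on Fin k → ℝ with mean vector f_w(D) = (1/n) · Σ_i w i • clip(φ(D i), C) and per-coordinate variance σ². Fix a dataset D and an index i with clip(φ(D i), C) ≠ 0, and define the sharper record-dependent quantity ε_i = (w i · ‖clip(φ(D i), C)‖₂ / (n · σ)) · √(2 · log(1.25 / δ_t)); assume ε_i < 1. Then for every measurable set S ⊆ (Fin k → ℝ), (M D) S ≤ exp(ε_i) · (M D^(−i)) S + δ_t, where D^(−i) = Function.update D i ⊥. In particular, choosing the weight w i so that w i · ‖clip(φ(D i), C)‖₂ ≤ τ_inf caps the per-instance privacy loss of record i at (τ_inf / (n · σ)) · √(2 · log(1.25 / δ_t)). -/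

import Mathlib

open MeasureTheory ProbabilityTheory

/-- ℓ₂ clipping of `u` to norm at most `C`: `clip u C = min(1, C/‖u‖) • u`
(so `clip 0 C = 0`, matching the convention `clip(0,C)=0` since `C/0 = 0` in Lean). -/
noncomputable def clip {k : ℕ} (u : EuclideanSpace ℝ (Fin k)) (C : ℝ) :
    EuclideanSpace ℝ (Fin k) :=
  (min 1 (C / ‖u‖)) • u

/-- Weighted clipped aggregate `f_w(D) = (1/n) Σ_i w_i • clip(φ(D_i), C)`. -/
noncomputable def fw {Z : Type*} {k n : ℕ} (φ : Z → EuclideanSpace ℝ (Fin k)) (C : ℝ)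
    (w : Fin n → ℝ) (D : Fin n → Z) : EuclideanSpace ℝ (Fin k) :=
  (1 / (n : ℝ)) • ∑ i, w i • clip (φ (D i)) C

open scoped ENNReal NNReal

lemma aux_pi_withDensity {k : ℕ} (μ ν : Fin k → Measure ℝ) [∀ j, IsProbabilityMeasure (μ j)]
    [∀ j, IsProbabilityMeasure (ν j)] (f : Fin k → ℝ → ℝ≥0∞) (hf : ∀ j, Measurable (f j))
    (h : ∀ j, ν j = (μ j).withDensity (f j)) :
    Measure.pi ν = (Measure.pi μ).withDensity (fun x => ∏ j, f j (x j)) := by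
  symm
  refine (Measure.pi_eq (μ := ν) ?_).symm ▸ rfl
  intro s hs
  rw [withDensity_apply _ (MeasurableSet.univ_pi hs), ← lintegral_indicator (MeasurableSet.univ_pi hs)]
  have h1 : (fun x : Fin k → ℝ => (Set.univ.pi s).indicator (fun x => ∏ j, f j (x j)) x)
      = fun x => ∏ j, (s j).indicator (f j) (x j) := by
    funext x
    by_cases hx : x ∈ Set.univ.pi s
    · rw [Set.indicator_of_mem hx]
      refine Finset.prod_congr rfl fun j _ => ?_
      rw [Set.indicator_of_mem (hx j (Set.mem_univ j))]
    · rw [Set.indicator_of_notMem hx]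
      simp only [Set.mem_pi, Set.mem_univ, true_implies, not_forall] at hx
      obtain ⟨j, hj⟩ := hx
      rw [Finset.prod_eq_zero (Finset.mem_univ j)]
      rw [Set.indicator_of_notMem hj]
  rw [h1]
  have hm : ∀ j, Measurable ((s j).indicator (f j)) := fun j => (hf j).indicator (hs j)
  have hind : iIndepFun (fun j (x : Fin k → ℝ) => (s j).indicator (f j) (x j)) (Measure.pi μ) :=
    iIndepFun_pi (fun j => (hm j).aemeasurable)
  rw [lintegral_prod_eq_prod_lintegral_of_indepFun Finset.univ _ hind
    (fun j => (hm j).comp (measurable_pi_apply j))]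
  refine Finset.prod_congr rfl fun j _ => ?_
  rw [h j, withDensity_apply _ (hs j), ← lintegral_indicator (hs j)]
  exact (measurePreserving_eval μ j).lintegral_comp (hm j)

lemma aux_gauss_withDensity (m1 m0 : ℝ) (V : ℝ≥0) (hV : V ≠ 0) :
    gaussianReal m1 V = (gaussianReal m0 V).withDensity
      (fun x => ENNReal.ofReal (Real.exp (((x - m0)^2 - (x - m1)^2) / (2 * V)))) := by
  rw [gaussianReal_of_var_ne_zero _ hV, gaussianReal_of_var_ne_zero _ hV,
    ← withDensity_mul _ (measurable_gaussianPDF _ _) (by fun_prop)]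
  congr 1
  funext x
  simp only [Pi.mul_apply, gaussianPDF]
  rw [← ENNReal.ofReal_mul (gaussianPDFReal_nonneg _ _ _)]
  congr 1
  simp only [gaussianPDFReal]
  rw [mul_assoc (√(2 * Real.pi * V))⁻¹, ← Real.exp_add]
  congr 2
  ring

lemma aux_mech {k : ℕ} (m1 m0 : Fin k → ℝ) (V : ℝ≥0) (hV : V ≠ 0) (ε : ℝ)
    (S : Set (Fin k → ℝ)) (hS : MeasurableSet S) :
    Measure.pi (fun j => gaussianReal (m1 j) V) S ≤
      ENNReal.ofReal (Real.exp ε) * Measure.pi (fun j => gaussianReal (m0 j) V) S +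
      Measure.pi (fun j => gaussianReal (m1 j) V)
        {x | ε < ∑ j, ((x j - m0 j)^2 - (x j - m1 j)^2) / (2 * (V:ℝ))} := by
  set B : Set (Fin k → ℝ) := {x | ε < ∑ j, ((x j - m0 j)^2 - (x j - m1 j)^2) / (2 * (V:ℝ))} with hB
  have hBm : MeasurableSet B := measurableSet_lt measurable_const (by fun_prop)
  refine (measure_le_inter_add_sdiff _ S Bᶜ).trans ?_
  refine add_le_add ?_ (measure_mono (fun x hx => by simpa using hx.2))
  have hd := aux_pi_withDensity (fun j => gaussianReal (m0 j) V) (fun j => gaussianReal (m1 j) V)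
    _ (fun j => by fun_prop) (fun j => aux_gauss_withDensity (m1 j) (m0 j) V hV)
  rw [hd, withDensity_apply _ (hS.inter hBm.compl)]
  refine (setLIntegral_mono (g := fun _ => ENNReal.ofReal (Real.exp ε)) measurable_const ?_).trans ?_
  · intro x hx
    rw [← ENNReal.ofReal_prod_of_nonneg (fun j _ => (Real.exp_pos _).le), ← Real.exp_sum]
    refine ENNReal.ofReal_le_ofReal (Real.exp_le_exp.2 ?_)
    exact not_lt.1 hx.2
  · rw [setLIntegral_const]
    gcongr
    exact Set.inter_subset_left

lemma aux_law {k : ℕ} (m v : Fin k → ℝ) (V : ℝ≥0) (W : ℝ≥0) (hW : (W:ℝ) = V * ∑ j, v j ^ 2) :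
    (Measure.pi (fun j => gaussianReal (m j) V)).map (fun x => ∑ j, v j * (x j - m j))
      = gaussianReal 0 W := by
  have hmeas : Measurable (fun x : Fin k → ℝ => ∑ j, v j * (x j - m j)) := by fun_prop
  have : IsProbabilityMeasure
    ((Measure.pi (fun j => gaussianReal (m j) V)).map (fun x => ∑ j, v j * (x j - m j))) :=
    Measure.isProbabilityMeasure_map hmeas.aemeasurable
  apply Measure.ext_of_charFun
  funext t
  rw [charFun_gaussianReal, charFun_apply_real, integral_map hmeas.aemeasurable (by fun_prop)]
  have h1 : ∀ x : Fin k → ℝ, Complex.exp (t * ((∑ j, v j * (x j - m j) : ℝ) : ℂ) * Complex.I)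
      = ∏ j, (fun y : ℝ => Complex.exp (((t * v j : ℝ) : ℂ) * y * Complex.I) *
          Complex.exp (-((t * v j * m j : ℝ):ℂ) * Complex.I)) (x j) := by
    intro x
    simp only [← Complex.exp_add]
    rw [← Complex.exp_sum]
    congr 1
    push_cast
    rw [Finset.mul_sum, Finset.sum_mul]
    refine Finset.sum_congr rfl fun j _ => ?_
    ring
  simp_rw [h1]
  rw [integral_fintype_prod_eq_prod (μ := fun j => gaussianReal (m j) V)
    (f := fun j (y : ℝ) => Complex.exp (((t * v j : ℝ) : ℂ) * y * Complex.I) *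
          Complex.exp (-((t * v j * m j : ℝ):ℂ) * Complex.I))]
  have h2 : ∀ j, ∫ y : ℝ, Complex.exp (((t * v j : ℝ) : ℂ) * y * Complex.I) *
          Complex.exp (-((t * v j * m j : ℝ):ℂ) * Complex.I) ∂(gaussianReal (m j) V)
      = Complex.exp (-((V * v j ^ 2 * t ^ 2 / 2 : ℝ) : ℂ)) := by
    intro j
    rw [integral_mul_const, ← charFun_apply_real, charFun_gaussianReal, ← Complex.exp_add]
    congr 1
    push_cast
    ring
  simp_rw [h2]
  rw [← Complex.exp_sum]
  congr 1
  have hW' : (W : ℂ) = V * ∑ j, (v j : ℂ) ^ 2 := by exact_mod_cast congrArg (fun r : ℝ => (r : ℂ)) hW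
  rw [hW']
  push_cast
  rw [Finset.mul_sum, Finset.sum_mul, Finset.sum_div]
  simp [Finset.sum_neg_distrib]

lemma aux_half : gaussianReal 0 1 (Set.Ioi 0) ≤ ENNReal.ofReal (1/2) := by
  have h1 : gaussianReal 0 1 (Set.Iio 0) = gaussianReal 0 1 (Set.Ioi 0) := by
    conv_lhs => rw [← neg_zero, ← gaussianReal_map_neg]
    rw [Measure.map_apply (by fun_prop) measurableSet_Iio]
    congr 1
    ext x; simp
  have h2 : gaussianReal 0 1 (Set.Iio 0) + gaussianReal 0 1 (Set.Ioi 0) ≤ 1 := by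
    rw [← measure_union (s₁ := Set.Iio (0:ℝ)) (s₂ := Set.Ioi 0)
      (Set.disjoint_left.2 fun x hx hy => lt_asymm (Set.mem_Iio.1 hx) (Set.mem_Ioi.1 hy))
      measurableSet_Ioi]
    exact prob_le_one
  rw [h1] at h2
  have hne : gaussianReal 0 1 (Set.Ioi 0) ≠ ∞ := measure_ne_top _ _
  rw [ENNReal.le_ofReal_iff_toReal_le hne (by norm_num)]
  have := ENNReal.toReal_mono (by simp) h2
  rw [ENNReal.toReal_add hne hne] at this
  simp at this
  linarith

lemma aux_tail_pos (t : ℝ) (ht : 0 ≤ t) :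
    gaussianReal 0 1 (Set.Ioi t) ≤ ENNReal.ofReal (Real.exp (-t^2/2) * (1/2)) := by
  have h1 : gaussianReal 0 1 (Set.Ioi t) = gaussianReal (-t) 1 (Set.Ioi 0) := by
    have := gaussianReal_map_sub_const (μ := 0) (v := 1) t
    rw [zero_sub] at this
    rw [← this, Measure.map_apply (by fun_prop) measurableSet_Ioi]
    congr 1
    ext x; simp
  rw [h1, ENNReal.ofReal_mul (Real.exp_pos _).le]
  refine le_trans ?_ (mul_le_mul_right aux_half _)
  rw [gaussianReal_apply _ one_ne_zero, gaussianReal_apply _ one_ne_zero,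
    ← lintegral_const_mul _ (measurable_gaussianPDF _ _)]
  refine setLIntegral_mono (by fun_prop) fun x hx => ?_
  rw [gaussianPDF, gaussianPDF, ← ENNReal.ofReal_mul (Real.exp_pos _).le]
  apply ENNReal.ofReal_le_ofReal
  simp only [gaussianPDFReal]
  rw [mul_left_comm, ← Real.exp_add]
  gcongr
  have := mul_nonneg ht (le_of_lt (Set.mem_Ioi.1 hx))
  simp
  nlinarith

lemma aux_tail_neg (t : ℝ) (ht : t ≤ 0) :
    gaussianReal 0 1 (Set.Ioi t) ≤ ENNReal.ofReal (-t + 1/2) := by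
  rw [← Set.Ioc_union_Ioi_eq_Ioi ht, ENNReal.ofReal_add (by linarith) (by norm_num)]
  refine (measure_union_le _ _).trans (add_le_add ?_ aux_half)
  rw [gaussianReal_apply _ one_ne_zero]
  refine (setLIntegral_mono (g := fun _ => 1) measurable_const ?_).trans ?_
  · intro x hx
    rw [gaussianPDF, ← ENNReal.ofReal_one]
    apply ENNReal.ofReal_le_ofReal
    simp only [gaussianPDFReal]
    have h1 : (1:ℝ) ≤ √(2 * Real.pi * (1:ℝ≥0)) := by
      rw [Real.one_le_sqrt]
      have := Real.pi_gt_three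
      simp; linarith
    have h2 : Real.exp (-(x - 0)^2 / (2 * (1:ℝ≥0))) ≤ 1 := by
      rw [Real.exp_le_one_iff]
      simp
      nlinarith [sq_nonneg x]
    exact mul_le_one₀ (inv_le_one_of_one_le₀ h1) (Real.exp_pos _).le h2
  · simp

lemma aux_num (δ c s : ℝ) (hδ0 : 0 < δ) (hδ1 : δ < 1) (hc : c = √(2 * Real.log (1.25 / δ)))
    (hs : 0 < s) (hsc : s * c < 1) :
    gaussianReal 0 1 (Set.Ioi (c - s / 2)) ≤ ENNReal.ofReal δ := by
  have hl : (0.2:ℝ) < Real.log (1.25 / δ) := by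
    have h1 : Real.log 1.25 < Real.log (1.25 / δ) := by
      apply Real.log_lt_log (by norm_num)
      rw [lt_div_iff₀ hδ0]; nlinarith
    have h2 := Real.one_sub_inv_le_log_of_pos (x := 1.25) (by norm_num)
    norm_num at h2 h1 ⊢
    linarith
  have hc2 : c ^ 2 = 2 * Real.log (1.25 / δ) := by rw [hc, Real.sq_sqrt (by linarith)]
  have hc0 : 0 ≤ c := hc ▸ Real.sqrt_nonneg _
  have hexp : Real.exp (-c^2/2) * 1.25 = δ := by
    rw [hc2, show -(2 * Real.log (1.25 / δ)) / 2 = - Real.log (1.25/δ) by ring, Real.exp_neg,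
      Real.exp_log (by positivity)]
    field_simp
  have hc5 : (1/2:ℝ) ≤ c := by nlinarith
  rcases le_total 0 (c - s/2) with ht | ht
  · refine (aux_tail_pos _ ht).trans (ENNReal.ofReal_le_ofReal ?_)
    rw [← hexp]
    have h1 : Real.exp (-(c - s/2)^2/2) ≤ Real.exp (-c^2/2) * Real.exp (1/2) := by
      rw [← Real.exp_add]
      apply Real.exp_le_exp.2
      nlinarith [sq_nonneg s]
    have h2 : Real.exp (1/2) ≤ 2.5 := by
      have h3 : Real.exp (1/2) * Real.exp (1/2) = Real.exp 1 := by rw [← Real.exp_add]; norm_num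
      have := Real.exp_one_lt_d9
      by_contra hh
      push Not at hh
      nlinarith
    have := Real.exp_pos (-c^2/2)
    nlinarith
  · refine (aux_tail_neg _ ht).trans (ENNReal.ofReal_le_ofReal ?_)
    have h1 := Real.add_one_le_exp (-c^2/2)
    have h2 : c^2 ≤ 1/2 := by nlinarith
    have h3 : s/2 - c ≤ 0.3 := by
      by_contra hh
      push Not at hh
      nlinarith
    norm_num at *
    linarith

lemma aux_full {k : ℕ} (m1 m0 : Fin k → ℝ) (σ a δ ε : ℝ) (V : ℝ≥0) (hVσ : (V:ℝ) = σ^2) (hσ : 0 < σ) (ha : 0 < a)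
    (hδ0 : 0 < δ) (hδ1 : δ < 1) (hsum : ∑ j, (m1 j - m0 j)^2 = a^2)
    (hεd : ε = a / σ * √(2 * Real.log (1.25 / δ))) (hε : ε < 1)
    (S : Set (Fin k → ℝ)) (hS : MeasurableSet S) :
    Measure.pi (fun j => gaussianReal (m1 j) V) S ≤
      ENNReal.ofReal (Real.exp ε) * Measure.pi (fun j => gaussianReal (m0 j) V) S +
      ENNReal.ofReal δ := by
  have hV : V ≠ 0 := by
    intro h
    rw [h] at hVσ
    simp at hVσ
    exact (pow_pos hσ 2).ne' hVσ.symm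
  refine (aux_mech m1 m0 _ hV ε S hS).trans (add_le_add le_rfl ?_)
  refine le_trans (le_of_eq ?_) (aux_num δ _ (a/σ) hδ0 hδ1 rfl (by positivity) (hεd ▸ hε))
  have hlaw := aux_law m1 (fun j => m1 j - m0 j) V (NNReal.mk ((a*σ)^2) (sq_nonneg _))
    (by rw [NNReal.coe_mk, hsum, hVσ]; ring)
  have hsc : (gaussianReal 0 1).map (fun x => (a*σ) * x)
      = gaussianReal 0 (NNReal.mk ((a*σ)^2) (sq_nonneg _)) := by
    rw [gaussianReal_map_const_mul]; simp
  rw [← hsc] at hlaw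
  have hT : MeasurableSet {y : ℝ | ε < y / σ^2 + a^2/(2*σ^2)} :=
    measurableSet_lt measurable_const (by fun_prop)
  have := congrArg (fun μ : Measure ℝ => μ {y : ℝ | ε < y / σ^2 + a^2/(2*σ^2)}) hlaw
  rw [Measure.map_apply (by fun_prop) hT, Measure.map_apply (by fun_prop) hT] at this
  convert this using 2
  · ext x
    simp only [Set.mem_setOf_eq, Set.mem_preimage, hVσ]
    rw [← hsum, Finset.sum_div, Finset.sum_div, ← Finset.sum_add_distrib]
    have : ∀ j, ((x j - m0 j)^2 - (x j - m1 j)^2) / (2 * σ^2) =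
      (m1 j - m0 j) * (x j - m1 j) / σ^2 + (m1 j - m0 j)^2 / (2*σ^2) := by
      intro j; field_simp; ring
    simp_rw [this]
  · ext x
    simp only [Set.mem_setOf_eq, Set.mem_preimage, Set.mem_Ioi]
    rw [hεd]
    have e : a * σ * x / σ^2 + a^2/(2*σ^2) = a/σ * (x + a/σ/2) := by field_simp
    rw [e, mul_lt_mul_iff_right₀ (by positivity)]
    constructor <;> intro h <;> linarith

/-- Sharper record-dependent per-instance bound. Record `i` satisfies the
`(ε_i, δ_t)` per-instance bound with
`ε_i = (w_i ‖clip(φ(D_i),C)‖/(nσ))·√(2 log(1.25/δ_t)) < 1`; in particular, if the weight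
is chosen so that `w_i · ‖clip(φ(D_i),C)‖ ≤ τ_inf`, the per-instance privacy loss is
capped at `(τ_inf/(nσ))·√(2 log(1.25/δ_t))`. -/
theorem sharper_per_instance_bound
    {Z : Type*} {k : ℕ} (nullz : Z) (n : ℕ) (hn : 0 < n)
    (C σ δt : ℝ) (hC : 0 < C) (hσ : 0 < σ) (hδt0 : 0 < δt) (hδt1 : δt < 1)
    (φ : Z → EuclideanSpace ℝ (Fin k)) (hφ : φ nullz = 0)
    (w : Fin n → ℝ) (hw : ∀ i, 0 < w i ∧ w i ≤ 1)
    (D : Fin n → Z) (i : Fin n) (hclip : clip (φ (D i)) C ≠ 0)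
    (hε : (w i * ‖clip (φ (D i)) C‖ / ((n : ℝ) * σ)) *
        Real.sqrt (2 * Real.log (1.25 / δt)) < 1) :
    (∀ S : Set (Fin k → ℝ), MeasurableSet S →
        Measure.pi (fun j => gaussianReal (fw φ C w D j) ⟨σ ^ 2, sq_nonneg σ⟩) S ≤
          ENNReal.ofReal
              (Real.exp ((w i * ‖clip (φ (D i)) C‖ / ((n : ℝ) * σ)) *
                Real.sqrt (2 * Real.log (1.25 / δt)))) *
            Measure.pi (fun j =>
              gaussianReal (fw φ C w (Function.update D i nullz) j)
                ⟨σ ^ 2, sq_nonneg σ⟩) S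
          + ENNReal.ofReal δt) ∧
      (∀ τinf : ℝ, w i * ‖clip (φ (D i)) C‖ ≤ τinf →
        ∀ S : Set (Fin k → ℝ), MeasurableSet S →
          Measure.pi (fun j => gaussianReal (fw φ C w D j) ⟨σ ^ 2, sq_nonneg σ⟩) S ≤
            ENNReal.ofReal
                (Real.exp ((τinf / ((n : ℝ) * σ)) *
                  Real.sqrt (2 * Real.log (1.25 / δt)))) *
              Measure.pi (fun j =>
                gaussianReal (fw φ C w (Function.update D i nullz) j)
                  ⟨σ ^ 2, sq_nonneg σ⟩) S
            + ENNReal.ofReal δt) := by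
  have hn' : (0:ℝ) < n := by exact_mod_cast hn
  have hcl : 0 < ‖clip (φ (D i)) C‖ := norm_pos_iff.2 hclip
  have hdiff : fw φ C w D - fw φ C w (Function.update D i nullz)
      = (w i / (n:ℝ)) • clip (φ (D i)) C := by
    unfold fw
    rw [← smul_sub, ← Finset.sum_sub_distrib, Finset.sum_eq_single i]
    · simp [hφ, clip, smul_smul]
      ring_nf
    · intro j _ hj
      simp [Function.update_of_ne hj]
    · simp
  have hsum : ∑ j, (fw φ C w D j - fw φ C w (Function.update D i nullz) j)^2
      = (w i * ‖clip (φ (D i)) C‖ / n)^2 := by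
    have h1 := EuclideanSpace.real_norm_sq_eq (fw φ C w D - fw φ C w (Function.update D i nullz))
    simp only [PiLp.sub_apply] at h1
    rw [← h1, hdiff, norm_smul, Real.norm_of_nonneg (div_nonneg (hw i).1.le hn'.le)]
    ring
  have main : ∀ S : Set (Fin k → ℝ), MeasurableSet S →
        Measure.pi (fun j => gaussianReal (fw φ C w D j) ⟨σ ^ 2, sq_nonneg σ⟩) S ≤
          ENNReal.ofReal
              (Real.exp ((w i * ‖clip (φ (D i)) C‖ / ((n : ℝ) * σ)) *
                Real.sqrt (2 * Real.log (1.25 / δt)))) *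
            Measure.pi (fun j =>
              gaussianReal (fw φ C w (Function.update D i nullz) j)
                ⟨σ ^ 2, sq_nonneg σ⟩) S
          + ENNReal.ofReal δt := by
    intro S hS
    exact aux_full _ _ σ (w i * ‖clip (φ (D i)) C‖ / n) δt _ ⟨σ ^ 2, sq_nonneg σ⟩ rfl hσ
      (div_pos (mul_pos (hw i).1 hcl) hn') hδt0 hδt1 hsum (by rw [div_div]) hε S hS
  refine ⟨main, fun τ hτ S hS => (main S hS).trans ?_⟩
  gcongr
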